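/- arXiv:2502.01874 — 8 statements merged into one kernel-verified Lean document; each statement's English description precedes it below -/
import Mathlib

section
/- Let c > 0, let x ∈ ℝ^n, and let ŷ be a minimizer over ℝ of F(y) = Σ_{i=1}^n H_c(x_i − y). Let I = {i : |x_i − ŷ| < c} and suppose I is nonempty. Then |I| · ŷ = c · Σ_{i ∉ I} sgn(x_i − ŷ) + Σ_{i ∈ I} x_i, where sgn denotes the sign function. -/
/-- The Huber loss with parameter `c`. -/
noncomputable def huber (c x : ℝ) : ℝ :=
  if |x| ≤ c then x ^ 2 / 2 else c * (|x| - c / 2)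

/-- The Huber loss lies below each function of its infimal-convolution representation. -/
theorem huber_le_sq_add_abs {c : ℝ} (hc : 0 ≤ c) (u v : ℝ) :
    huber c u ≤ (u - v) ^ 2 / 2 + c * |v| := by
  unfold huber
  split_ifs with h
  · have huv : u * v ≤ c * |v| := calc
      u * v ≤ |u| * |v| := by rw [← abs_mul]; exact le_abs_self _
      _ ≤ c * |v| := by gcongr
    nlinarith [sq_nonneg v]
  · have htri : |u| ≤ |u - v| + |v| := by simpa using abs_add_le (u - v) v
    nlinarith [sq_nonneg (|u - v| - c), sq_abs (u - v), mul_le_mul_of_nonneg_left htri hc]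

/-- The score function (derivative) of the Huber loss. -/
noncomputable def huberScore (c t : ℝ) : ℝ :=
  if |t| < c then t else c * Real.sign t

/-- The Huber loss is `1`-smooth: it satisfies the quadratic upper bound. -/
theorem huber_sub_le {c : ℝ} (hc : 0 < c) (t h : ℝ) :
    huber c (t - h) ≤ huber c t - h * huberScore c t + h ^ 2 / 2 := by
  unfold huberScore
  split_ifs with ht
  · have key := huber_le_sq_add_abs hc.le (t - h) 0
    have hval : huber c t = t ^ 2 / 2 := if_pos ht.le
    rw [abs_zero] at key
    rw [hval]
    linarith
  · have hct : c ≤ |t| := not_lt.mp ht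
    have hval : huber c t = c * (|t| - c / 2) := by
      unfold huber
      split_ifs with hle
      · rw [← sq_abs t, le_antisymm hle hct]
        ring
      · rfl
    rw [hval]
    rcases lt_trichotomy t 0 with hneg | rfl | hpos
    · have key := huber_le_sq_add_abs hc.le (t - h) (t + c)
      rw [abs_of_neg hneg] at hct ⊢
      rw [abs_of_nonpos (by linarith : t + c ≤ 0)] at key
      rw [Real.sign_of_neg hneg]
      linarith
    · rw [abs_zero] at hct
      exact absurd hc hct.not_gt
    · have key := huber_le_sq_add_abs hc.le (t - h) (t - c)
      rw [abs_of_pos hpos] at hct ⊢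
      rw [abs_of_nonneg (by linarith : 0 ≤ t - c)] at key
      rw [Real.sign_of_pos hpos]
      linarith

/-- First-order optimality: the scores of the residuals at a Huber M-estimator sum to zero. -/
theorem sum_huberScore_eq_zero {ι : Type*} [Fintype ι] {c : ℝ} (hc : 0 < c) (x : ι → ℝ) (yhat : ℝ)
    (hmin : ∀ y : ℝ, ∑ i, huber c (x i - yhat) ≤ ∑ i, huber c (x i - y)) :
    ∑ i, huberScore c (x i - yhat) = 0 := by
  set S := ∑ i, huberScore c (x i - yhat) with hS
  have hquad (h : ℝ) : h * S ≤ Fintype.card ι * (h ^ 2 / 2) := by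
    have hsum : ∑ i, huber c (x i - (yhat + h)) ≤
        ∑ i, (huber c (x i - yhat) - h * huberScore c (x i - yhat) + h ^ 2 / 2) :=
      Finset.sum_le_sum fun i _ => by
        rw [← sub_sub]
        exact huber_sub_le hc _ _
    rw [Finset.sum_add_distrib, Finset.sum_sub_distrib, ← Finset.mul_sum, ← hS,
      Finset.sum_const, Finset.card_univ, nsmul_eq_mul] at hsum
    linarith [hmin (yhat + h)]
  have hcard : (0 : ℝ) ≤ Fintype.card ι := Nat.cast_nonneg _
  have hpos : (0 : ℝ) < Fintype.card ι + 1 := by linarith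
  have hopt := hquad (S / (Fintype.card ι + 1))
  have hle : S ^ 2 * (Fintype.card ι + 2) ≤ 0 := by
    field_simp at hopt
    nlinarith
  nlinarith [sq_nonneg S, mul_nonneg (sq_nonneg S) hcard]

/-- If `ŷ` minimizes `F y = ∑ i, H_c (x i - y)` with `c > 0`, and
`I = {i : |x i - ŷ| < c}` is nonempty, then
`|I| * ŷ = c * ∑_{i ∉ I} sgn (x i - ŷ) + ∑_{i ∈ I} x i`. -/
theorem huber_minimizer_identity
    (n : ℕ) (c : ℝ) (hc : 0 < c) (x : Fin n → ℝ) (yhat : ℝ)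
    (hmin : ∀ y : ℝ, ∑ i, huber c (x i - yhat) ≤ ∑ i, huber c (x i - y))
    (I : Finset (Fin n)) (hI : I = Finset.univ.filter fun i => |x i - yhat| < c)
    (hIne : I.Nonempty) :
    (I.card : ℝ) * yhat = c * ∑ i ∈ Iᶜ, Real.sign (x i - yhat) + ∑ i ∈ I, x i := by
  have hscore := sum_huberScore_eq_zero hc x yhat hmin
  rw [← Finset.sum_add_sum_compl I] at hscore
  have hin : ∑ i ∈ I, huberScore c (x i - yhat) = ∑ i ∈ I, x i - I.card * yhat := by
    rw [← nsmul_eq_mul, ← Finset.sum_const, ← Finset.sum_sub_distrib]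
    refine Finset.sum_congr rfl fun i hi => if_pos ?_
    simpa [hI] using hi
  have hout : ∑ i ∈ Iᶜ, huberScore c (x i - yhat) = c * ∑ i ∈ Iᶜ, Real.sign (x i - yhat) := by
    rw [Finset.mul_sum]
    refine Finset.sum_congr rfl fun i hi => if_neg ?_
    simpa [hI] using hi
  linarith
end

section
/- Let n be odd, let x ∈ ℝ^n have pairwise distinct entries, and let med be the ((n+1)/2)-th smallest entry of x (the median). If 0 < c ≤ min{ |x_i − med| : x_i ≠ med }, then med is the unique minimizer over ℝ of F(y) = Σ_{i=1}^n H_c(x_i − y). (This makes precise the claim that the Huber M-estimator with sufficiently small parameter c equals the median.) -/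
theorem huber_zero {c : ℝ} (hc : 0 < c) : huber c 0 = 0 := by
  simp [huber, hc.le]

theorem huber_pos {c z : ℝ} (hc : 0 < c) (hz : z ≠ 0) : 0 < huber c z := by
  unfold huber
  split_ifs with h
  · positivity
  · exact mul_pos hc (by linarith)

theorem mul_abs_sub_le_huber (c z : ℝ) : c * (|z| - c / 2) ≤ huber c z := by
  unfold huber
  split_ifs with h
  · nlinarith [sq_nonneg (|z| - c), sq_abs z]
  · exact le_rfl

theorem huber_of_le_abs {c z : ℝ} (h : c ≤ |z|) : huber c z = c * (|z| - c / 2) := by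
  unfold huber
  split_ifs with h'
  · rw [← sq_abs, le_antisymm h' h]
    ring
  · rfl

/-- Let `n` be odd and let `x` have pairwise distinct entries, with
`med` the `((n+1)/2)`-th smallest entry (so `med` is attained and exactly `(n+1)/2`
entries are `≤ med`). If `0 < c ≤ min {|x i - med| : x i ≠ med}`, then `med` is the
unique minimizer of `y ↦ ∑ i, H_c (x i - y)`. -/
theorem huber_small_c_median_minimizes
    (n : ℕ) (hn : Odd n) (x : Fin n → ℝ) (hinj : Function.Injective x)
    (med : ℝ) (hmem : med ∈ Set.range x)
    (hcount : (Finset.univ.filter fun i => x i ≤ med).card = (n + 1) / 2)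
    (c : ℝ) (hc : 0 < c) (hcle : ∀ i, x i ≠ med → c ≤ |x i - med|) :
    ∀ y : ℝ, y ≠ med → ∑ i, huber c (x i - med) < ∑ i, huber c (x i - y) := by
  intro y hy
  obtain ⟨i₀, rfl⟩ := hmem
  let s : Fin n → ℝ := fun i => 1 - 2 * (if x i ≤ x i₀ then 1 else 0) + if i = i₀ then 1 else 0
  have hs : ∑ i, s i = 0 := by
    obtain ⟨k, rfl⟩ := hn
    have hk : (2 * k + 1 + 1) / 2 = k + 1 := by omega
    simp only [s, Finset.sum_add_distrib, Finset.sum_sub_distrib, ← Finset.mul_sum,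
      Finset.sum_boole, hcount, hk]
    simp [Finset.filter_eq']
    ring
  have hlt : ∑ i, (huber c (x i - x i₀) - c * (y - x i₀) * s i) < ∑ i, huber c (x i - y) := by
    have hcenter : huber c (x i₀ - x i₀) - c * (y - x i₀) * s i₀ < huber c (x i₀ - y) := by
      have hpos := huber_pos hc (sub_ne_zero.mpr hy.symm)
      have hs₀ : s i₀ = 0 := by norm_num [s]
      simpa [hs₀, huber_zero hc] using hpos
    refine Finset.sum_lt_sum (fun i _ => ?_) ⟨i₀, Finset.mem_univ _, hcenter⟩
    by_cases hi : i = i₀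
    · exact hi ▸ hcenter.le
    have hne : x i ≠ x i₀ := hinj.ne hi
    have hlow := mul_abs_sub_le_huber c (x i - y)
    rw [huber_of_le_abs (hcle i hne)]
    rcases hne.lt_or_gt with h | h
    · have hsi : s i = -1 := by norm_num [s, hi, h.le]
      rw [hsi, abs_of_neg (sub_neg.mpr h)]
      nlinarith [mul_le_mul_of_nonneg_left (neg_le_abs (x i - y)) hc.le]
    · have hsi : s i = 1 := by simp [s, hi, h]
      rw [hsi, abs_of_pos (sub_pos.mpr h)]
      nlinarith [mul_le_mul_of_nonneg_left (le_abs_self (x i - y)) hc.le]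
  simpa [Finset.sum_sub_distrib, ← Finset.mul_sum, hs] using hlt
end

section
/- Let n be a positive integer, W an n×n real matrix, s ∈ ℝ^n, and for α ∈ ℝ^n define X(α) = I − (I − Diag(α)) W. On the open set of α for which X(α) is invertible, the map α ↦ x*(α) = X(α)⁻¹ Diag(α) s is differentiable, and for each coordinate k its partial derivative is ∂x*/∂α_k = (s_k − (W x*(α))_k) · X(α)⁻¹ e_k, where e_k is the k-th standard basis vector; equivalently, the Jacobian matrix of x* at α equals X(α)⁻¹ · Diag(s − W x*(α)). -/
open Filter Topology Asymptotics in
/-- If `f α - f α₀ = A(α) (α - α₀)` near `α₀` with `A` continuous at `α₀`, then `f` has Fréchet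
derivative `A(α₀)` at `α₀`. -/
theorem hasFDerivAt_mulVecLin_of_slope {m n : Type*} [Fintype m] [Fintype n]
    {f : (n → ℝ) → m → ℝ} {A : (n → ℝ) → Matrix m n ℝ} {α₀ : n → ℝ}
    (hA : ContinuousAt A α₀)
    (hf : ∀ᶠ α in 𝓝 α₀, f α - f α₀ = (A α).mulVec (α - α₀)) :
    HasFDerivAt f (LinearMap.toContinuousLinearMap (Matrix.mulVecLin (A α₀))) α₀ := by
  rw [hasFDerivAt_iff_isLittleO]
  have hremainder : (fun α => (A α - A α₀).mulVec (α - α₀)) =o[𝓝 α₀] fun α => α - α₀ := by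
    rw [isLittleO_pi]
    intro i
    simp only [Matrix.mulVec, dotProduct]
    refine IsLittleO.fun_sum fun j _ => ?_
    have hentry : (fun α => (A α - A α₀) i j) =o[𝓝 α₀] fun _ => (1 : ℝ) := by
      rw [isLittleO_one_iff]
      have hij : ContinuousAt (fun α => A α i j) α₀ :=
        (continuous_apply_apply i j).continuousAt.comp hA
      simpa using hij.tendsto.sub_const (A α₀ i j)
    have hcoord : (fun α : n → ℝ => (α - α₀) j) =O[𝓝 α₀] fun α => ‖α - α₀‖ :=
      IsBigO.of_bound 1 (Eventually.of_forall fun α => by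
        simpa using norm_le_pi_norm (α - α₀) j)
    simpa using (hentry.mul_isBigO hcoord).congr_right fun α => one_mul _
  refine hremainder.congr' ?_ EventuallyEq.rfl
  filter_upwards [hf] with α hα
  rw [hα]
  simp [Matrix.sub_mulVec]


/-- Where `X α = I - (I - Diag α) W` is invertible, the equilibrium map
`α ↦ x*(α) = X(α)⁻¹ (Diag α) s` is differentiable with Jacobian
`X(α)⁻¹ * Diag (s - W x*(α))`; in particular the partial derivative in direction `e_k`
is `(s k - (W x*(α)) k) • X(α)⁻¹ e_k`. -/
theorem fj_equilibrium_hasFDerivAt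
    (n : ℕ) (W : Matrix (Fin n) (Fin n) ℝ) (s : Fin n → ℝ)
    (X : (Fin n → ℝ) → Matrix (Fin n) (Fin n) ℝ)
    (hX : ∀ α, X α = 1 - (1 - Matrix.diagonal α) * W)
    (xstar : (Fin n → ℝ) → Fin n → ℝ)
    (hxstar : ∀ α, xstar α = (X α)⁻¹.mulVec ((Matrix.diagonal α).mulVec s))
    (α0 : Fin n → ℝ) (hα0 : IsUnit (X α0)) :
    HasFDerivAt xstar
      (LinearMap.toContinuousLinearMap
        (Matrix.mulVecLin
          ((X α0)⁻¹ * Matrix.diagonal (fun k => s k - W.mulVec (xstar α0) k)))) α0 ∧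
    ∀ k : Fin n,
      ((X α0)⁻¹ * Matrix.diagonal (fun k => s k - W.mulVec (xstar α0) k)).mulVec
          (Pi.single k 1) =
        (s k - W.mulVec (xstar α0) k) • (X α0)⁻¹.mulVec (Pi.single k 1) := by
  constructor
  · have hdet : IsUnit (X α0).det := (Matrix.isUnit_iff_isUnit_det _).1 hα0
    have hXc : Continuous X := by
      rw [funext hX]
      fun_prop
    have hinv : ContinuousAt (fun α => (X α)⁻¹) α0 := by
      refine ContinuousAt.comp (g := Inv.inv) (continuousAt_matrix_inv _ ?_) hXc.continuousAt
      rw [Ring.inverse_eq_inv']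
      exact continuousAt_inv₀ hdet.ne_zero
    have hunit : ∀ᶠ α in nhds α0, IsUnit (X α).det :=
      (hXc.matrix_det.continuousAt.eventually_ne hdet.ne_zero).mono fun α h => h.isUnit
    refine hasFDerivAt_mulVecLin_of_slope
      (A := fun α => (X α)⁻¹ * Matrix.diagonal (fun k => s k - W.mulVec (xstar α0) k)) ?_ ?_
    · exact ((continuous_id.matrix_mul continuous_const).continuousAt).comp hinv
    · filter_upwards [hunit] with α hα
      have heq : (X α0).mulVec (xstar α0) = (Matrix.diagonal α0).mulVec s := by
        rw [hxstar, Matrix.mulVec_mulVec, Matrix.mul_nonsing_inv _ hdet, Matrix.one_mulVec]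
      have hcancel : xstar α0 = (X α)⁻¹.mulVec ((X α).mulVec (xstar α0)) := by
        rw [Matrix.mulVec_mulVec, Matrix.nonsing_inv_mul _ hα, Matrix.one_mulVec]
      conv_lhs => rw [hcancel, hxstar α]
      rw [← Matrix.mulVec_sub, ← Matrix.mulVec_mulVec]
      congr 1
      rw [hX, Matrix.sub_mulVec, Matrix.one_mulVec, ← Matrix.mulVec_mulVec, Matrix.sub_mulVec,
        Matrix.one_mulVec] at heq ⊢
      ext i
      have hi := congrFun heq i
      simp only [Pi.sub_apply, Matrix.mulVec_diagonal] at hi ⊢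
      linear_combination -hi
  · intro k
    rw [← Matrix.mulVec_mulVec, ← Matrix.mulVec_smul]
    congr 1
    ext i
    by_cases h : i = k
    · subst h
      simp [Matrix.mulVec_diagonal]
    · simp [Matrix.mulVec_diagonal, h]
end

section
/- Let n be a positive integer, W an n×n real matrix, s ∈ ℝ^n, and for α ∈ ℝ^n define X(α) = I − (I − Diag(α)) W and x*(α) = X(α)⁻¹ Diag(α) s on the open set where X(α) is invertible. Let g : ℝ^n → ℝ be differentiable. Then the composition α ↦ g(x*(α)) is differentiable on this set, and its gradient at α equals Diag(s − W x*(α)) · (X(α)⁻¹)ᵀ · ∇g(x*(α)). -/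
open Topology Asymptotics in
/-- The product of a continuous function and a continuous linear function vanishing at `a`
is differentiable at `a`. -/
theorem ContinuousAt.hasFDerivAt_mul_clm_sub {E : Type*} [NormedAddCommGroup E] [NormedSpace ℝ E]
    {f : E → ℝ} {a : E} (hf : ContinuousAt f a) (L : E →L[ℝ] ℝ) :
    HasFDerivAt (fun x => f x * L (x - a)) (f a • L) a := by
  rw [hasFDerivAt_iff_isLittleO]
  have h₁ : (fun x => f x - f a) =o[𝓝 a] fun _ => (1 : ℝ) :=
    (isLittleO_one_iff ℝ).2 (tendsto_sub_nhds_zero_iff.2 hf)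
  have h₂ : (fun x => L (x - a)) =O[𝓝 a] fun x => x - a := L.isBigO_sub _ _
  have h := h₁.mul_isBigO h₂.norm_right
  refine (h.congr (fun x => ?_) (fun x => one_mul _)).of_norm_right
  simp
  ring

/-- Matrix inversion is continuous at invertible matrices. -/
theorem Matrix.continuousAt_inv_of_isUnit {ι E : Type*} [Fintype ι] [DecidableEq ι]
    [TopologicalSpace E] {X : E → Matrix ι ι ℝ} {a : E} (hX : Continuous X) (ha : IsUnit (X a)) :
    ContinuousAt (fun x => (X x)⁻¹) a := by
  have hdet : (X a).det ≠ 0 := ((Matrix.isUnit_iff_isUnit_det _).1 ha).ne_zero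
  simp only [Matrix.inv_def, Ring.inverse_eq_inv']
  exact (hX.matrix_det.continuousAt.inv₀ hdet).smul hX.matrix_adjugate.continuousAt

/-- Where `1 - (1 - diagonal α) * W` is invertible, its equilibrium differs from any solution
`y` of the equilibrium equation at `β` by a term that is linear in `α - β` up to the inverse. -/
theorem fj_equilibrium_eq_add {ι : Type*} [Fintype ι] [DecidableEq ι] (W : Matrix ι ι ℝ)
    (s y α β : ι → ℝ) (hα : IsUnit (1 - (1 - Matrix.diagonal α) * W))
    (hy : (1 - (1 - Matrix.diagonal β) * W).mulVec y = (Matrix.diagonal β).mulVec s) :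
    (1 - (1 - Matrix.diagonal α) * W)⁻¹.mulVec ((Matrix.diagonal α).mulVec s) =
      y + (1 - (1 - Matrix.diagonal α) * W)⁻¹.mulVec
        (fun j => (s j - W.mulVec y j) * (α j - β j)) := by
  have hdet := (Matrix.isUnit_iff_isUnit_det _).1 hα
  have key : (Matrix.diagonal α).mulVec s = (1 - (1 - Matrix.diagonal α) * W).mulVec y +
      fun j => (s j - W.mulVec y j) * (α j - β j) := by
    ext j
    have hj := congrFun hy j
    simp only [Matrix.sub_mulVec, Matrix.one_mulVec, ← Matrix.mulVec_mulVec, Pi.sub_apply,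
      Pi.add_apply, Matrix.mulVec_diagonal] at hj ⊢
    linear_combination -hj
  rw [key, Matrix.mulVec_add, Matrix.mulVec_mulVec, Matrix.nonsing_inv_mul _ hdet,
    Matrix.one_mulVec]


/-- Where `X α = I - (I - Diag α) W` is invertible, for differentiable
`g : ℝⁿ → ℝ` the map `α ↦ g (x*(α))` is differentiable, and its gradient at `α` is
`Diag (s - W x*(α)) · (X α)⁻¹ᵀ · ∇g (x*(α))` (here `∇g` is the vector of partial
derivatives of `g`). -/
theorem fj_composite_gradient
    (n : ℕ) (W : Matrix (Fin n) (Fin n) ℝ) (s : Fin n → ℝ)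
    (X : (Fin n → ℝ) → Matrix (Fin n) (Fin n) ℝ)
    (hX : ∀ α, X α = 1 - (1 - Matrix.diagonal α) * W)
    (xstar : (Fin n → ℝ) → Fin n → ℝ)
    (hxstar : ∀ α, xstar α = (X α)⁻¹.mulVec ((Matrix.diagonal α).mulVec s))
    (g : (Fin n → ℝ) → ℝ) (hg : Differentiable ℝ g)
    (α0 : Fin n → ℝ) (hα0 : IsUnit (X α0)) :
    DifferentiableAt ℝ (fun α => g (xstar α)) α0 ∧
    ∀ v : Fin n → ℝ,
      fderiv ℝ (fun α => g (xstar α)) α0 v =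
        ∑ i,
          (Matrix.diagonal (fun k => s k - W.mulVec (xstar α0) k) * ((X α0)⁻¹).transpose).mulVec
              (fun j => fderiv ℝ g (xstar α0) (Pi.single j 1)) i * v i := by
  have hcont : Continuous X := by
    rw [funext hX]
    fun_prop
  have hinv := Matrix.continuousAt_inv_of_isUnit hcont hα0
  have hdet0 := (Matrix.isUnit_iff_isUnit_det _).1 hα0
  set d : Fin n → ℝ := fun k => s k - W.mulVec (xstar α0) k with hd
  have hbase : (X α0).mulVec (xstar α0) = (Matrix.diagonal α0).mulVec s := by
    rw [hxstar, Matrix.mulVec_mulVec, Matrix.mul_nonsing_inv _ hdet0, Matrix.one_mulVec]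
  have hev : ∀ᶠ α in nhds α0, xstar α =
      fun i => xstar α0 i + ∑ j, ((X α)⁻¹ i j * d j) *
        ContinuousLinearMap.proj (R := ℝ) (φ := fun _ : Fin n => ℝ) j (α - α0) := by
    filter_upwards [hcont.matrix_det.continuousAt.eventually_ne hdet0.ne_zero] with α hα
    have hu : IsUnit (X α) := (Matrix.isUnit_iff_isUnit_det _).2 hα.isUnit
    rw [hX] at hu hbase
    rw [hxstar α, hX α, fj_equilibrium_eq_add W s (xstar α0) α α0 hu hbase]
    ext i
    simp [Matrix.mulVec, dotProduct, hd, mul_assoc]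
  have hx : HasFDerivAt xstar (ContinuousLinearMap.pi fun i => ∑ j, ((X α0)⁻¹ i j * d j) •
      ContinuousLinearMap.proj (R := ℝ) (φ := fun _ : Fin n => ℝ) j) α0 := by
    refine HasFDerivAt.congr_of_eventuallyEq (hasFDerivAt_pi.2 fun i => ?_) hev
    refine HasFDerivAt.const_add _ (HasFDerivAt.fun_sum fun j _ => ?_)
    have hij : ContinuousAt (fun α => (X α)⁻¹ i j * d j) α0 :=
      ((continuous_id.matrix_elem i j).continuousAt.comp hinv).mul continuousAt_const
    exact hij.hasFDerivAt_mul_clm_sub _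
  have hcomp := (hg (xstar α0)).hasFDerivAt.comp α0 hx
  refine ⟨hcomp.differentiableAt, fun v => ?_⟩
  have hfd : fderiv ℝ (fun α => g (xstar α)) α0 = _ := hcomp.fderiv
  rw [hfd, ContinuousLinearMap.comp_apply, ← ContinuousLinearMap.coe_coe,
    LinearMap.pi_apply_eq_sum_univ]
  simp only [Matrix.mulVec, dotProduct, Matrix.diagonal_mul, Matrix.transpose_apply,
    ContinuousLinearMap.coe_pi', sum_apply, smul_apply, ContinuousLinearMap.proj_apply,
    smul_eq_mul, Finset.sum_mul, ContinuousLinearMap.coe_coe]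
  rw [Finset.sum_comm]
  refine Finset.sum_congr rfl fun i _ => Finset.sum_congr rfl fun j _ => ?_
  have hsingle : (fun k => if j = k then (1 : ℝ) else 0) = Pi.single j 1 := by
    ext k
    simp [Pi.single_apply, eq_comm]
  rw [hsingle]
  ring
end

section
/- Consider the set-cover gadget, and let J ⊆ {1,…,m}. Define resistances α' equal to the baseline gadget parameters except that α'(v_j) = 0 for every j ∈ J. Then every equilibrium x ∈ [0,1]^V of the directed FJ model with parameters (α', s) satisfies: x(w_j) = 1 for all j; x(v_j) = 1 for j ∈ J and x(v_j) = 0 for j ∉ J; and x(u_i) = |{j ∈ J : i ∈ S_j}| / |{j : i ∈ S_j}| for every element i. In particular, x(u_i) > 0 if and only if i belongs to the union ⋃_{j ∈ J} S_j. -/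
/-- Vertices of the set-cover gadget: element vertices `u_i`, set vertices `v_j`,
sink vertices `w_j`, and `ℓ` additional isolated vertices. -/
abbrev GadgetV (n m ℓ : ℕ) := (Fin n ⊕ Fin m ⊕ Fin m) ⊕ Fin ℓ

/-- The element vertex `u_i`. -/
abbrev uVert {n m ℓ : ℕ} (i : Fin n) : GadgetV n m ℓ := Sum.inl (Sum.inl i)

/-- The set vertex `v_j`. -/
abbrev vVert {n m ℓ : ℕ} (j : Fin m) : GadgetV n m ℓ := Sum.inl (Sum.inr (Sum.inl j))

/-- The sink vertex `w_j`. -/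
abbrev wVert {n m ℓ : ℕ} (j : Fin m) : GadgetV n m ℓ := Sum.inl (Sum.inr (Sum.inr j))

/-- Out-neighbors in the gadget: `u_i → v_j` whenever `i ∈ S j`, and `v_j → w_j`. -/
def gadgetNbrs {n m ℓ : ℕ} (S : Fin m → Finset (Fin n)) :
    GadgetV n m ℓ → Finset (GadgetV n m ℓ)
  | Sum.inl (Sum.inl i) => (Finset.univ.filter fun j => i ∈ S j).image (vVert ·)
  | Sum.inl (Sum.inr (Sum.inl j)) => {wVert j}
  | _ => ∅

/-- Equilibrium of the directed FJ model on the gadget: every vertex of positive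
out-degree averages, every sink keeps its innate opinion. -/
def IsGadgetEquilibrium {n m ℓ : ℕ} (S : Fin m → Finset (Fin n))
    (α s x : GadgetV n m ℓ → ℝ) : Prop :=
  ∀ z : GadgetV n m ℓ,
    ((gadgetNbrs S z).Nonempty →
      x z = α z * s z +
        (1 - α z) * ((∑ z' ∈ gadgetNbrs S z, x z') / ((gadgetNbrs S z).card : ℝ))) ∧
    (gadgetNbrs S z = ∅ → x z = s z)

/-- Baseline innate opinions: `1` on the sinks `w_j`, `0` elsewhere. -/
def gadgetS {n m ℓ : ℕ} : GadgetV n m ℓ → ℝ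
  | Sum.inl (Sum.inr (Sum.inr _)) => 1
  | _ => 0

/-- Baseline resistances: `0` on the element vertices `u_i`, `1` elsewhere. -/
def gadgetα {n m ℓ : ℕ} : GadgetV n m ℓ → ℝ
  | Sum.inl (Sum.inl _) => 0
  | _ => 1

/-- With resistances equal to the baseline except `α'(v_j) = 0` for
`j ∈ J`, every equilibrium `x ∈ [0,1]^V` satisfies `x(w_j) = 1`, `x(v_j) = 1` for
`j ∈ J` and `0` otherwise, and `x(u_i) = |{j ∈ J : i ∈ S_j}| / |{j : i ∈ S_j}|`; in
particular `x(u_i) > 0` iff `i` lies in `⋃_{j ∈ J} S_j`. -/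
theorem gadget_equilibrium_with_stooges
    (n m ℓ : ℕ) (hn : 1 ≤ n) (hm : 1 ≤ m)
    (S : Fin m → Finset (Fin n)) (hcover : ∀ i, ∃ j, i ∈ S j)
    (J : Finset (Fin m)) (α' : GadgetV n m ℓ → ℝ)
    (hα'v : ∀ j ∈ J, α' (vVert j) = 0)
    (hα'rest : ∀ z : GadgetV n m ℓ, (∀ j ∈ J, z ≠ vVert j) → α' z = gadgetα z)
    (x : GadgetV n m ℓ → ℝ) (hx01 : ∀ z, x z ∈ Set.Icc (0 : ℝ) 1)
    (heq : IsGadgetEquilibrium S α' gadgetS x) :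
    (∀ j, x (wVert j : GadgetV n m ℓ) = 1) ∧
    (∀ j, (j ∈ J → x (vVert j : GadgetV n m ℓ) = 1) ∧
          (j ∉ J → x (vVert j : GadgetV n m ℓ) = 0)) ∧
    (∀ i, x (uVert i : GadgetV n m ℓ) =
        ((J.filter fun j => i ∈ S j).card : ℝ) /
          ((Finset.univ.filter fun j => i ∈ S j).card : ℝ)) ∧
    (∀ i, 0 < x (uVert i : GadgetV n m ℓ) ↔ ∃ j ∈ J, i ∈ S j) := by
  have hw (j) : x (wVert j : GadgetV n m ℓ) = 1 := (heq (wVert j)).2 rfl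
  have hv (j) : x (vVert j : GadgetV n m ℓ) = if j ∈ J then 1 else 0 := by
    have h := (heq (vVert j)).1 (Finset.singleton_nonempty _)
    simp only [gadgetNbrs, gadgetS, Finset.sum_singleton, Finset.card_singleton, hw] at h
    split_ifs with hj
    · simpa [hα'v j hj] using h
    · have hα : α' (vVert j) = 1 :=
        hα'rest _ fun k hk hjk => hj (by simpa using (by simpa using hjk : j = k) ▸ hk)
      simpa [hα] using h
  have hu (i) : x (uVert i : GadgetV n m ℓ) =
      ((J.filter fun j => i ∈ S j).card : ℝ) /
        ((Finset.univ.filter fun j => i ∈ S j).card : ℝ) := by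
    obtain ⟨k, hk⟩ := hcover i
    have hinj : Function.Injective (vVert : Fin m → GadgetV n m ℓ) := fun a b hab => by
      simpa using hab
    have h := (heq (uVert i)).1 ⟨vVert k, Finset.mem_image_of_mem _ (by simpa using hk)⟩
    have hα : α' (uVert i) = 0 := hα'rest _ fun j _ => by simp
    have hfilter : (Finset.univ.filter fun j => i ∈ S j).filter (· ∈ J) =
        J.filter fun j => i ∈ S j := by
      ext j
      simp [and_comm]
    rw [h, hα]
    simp only [gadgetNbrs, zero_mul, zero_add, sub_zero, one_mul]
    rw [Finset.sum_image hinj.injOn, Finset.card_image_of_injective _ hinj,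
      Finset.sum_congr rfl fun j _ => hv j, Finset.sum_boole, hfilter]
  refine ⟨hw, fun j => ⟨fun hj => by simp [hv, hj], fun hj => by simp [hv, hj]⟩, hu,
    fun i => ?_⟩
  obtain ⟨k, hk⟩ := hcover i
  have hpos : (0 : ℝ) < ((Finset.univ.filter fun j => i ∈ S j).card : ℝ) :=
    Nat.cast_pos.2 (Finset.card_pos.2 ⟨k, by simpa using hk⟩)
  rw [hu, div_pos_iff_of_pos_right hpos, Nat.cast_pos, Finset.card_pos, Finset.filter_nonempty_iff]
end

section
/- Consider the set-cover gadget with arbitrary resistances α' ∈ [0,1]^V and the baseline innate opinions s. For every equilibrium x ∈ [0,1]^V of the directed FJ model with parameters (α', s) and every element i ∈ {1,…,n}: if x(u_i) > 0 then there exists j with i ∈ S_j and α'(v_j) < 1. -/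
/-- For arbitrary resistances `α' ∈ [0,1]^V` and the baseline innate
opinions, if at equilibrium `x(u_i) > 0` then some set `S_j` containing `i` has
`α'(v_j) < 1`. -/
theorem gadget_positive_needs_open_set
    (n m ℓ : ℕ) (hn : 1 ≤ n) (hm : 1 ≤ m)
    (S : Fin m → Finset (Fin n)) (hcover : ∀ i, ∃ j, i ∈ S j)
    (α' : GadgetV n m ℓ → ℝ) (hα' : ∀ z, α' z ∈ Set.Icc (0 : ℝ) 1)
    (x : GadgetV n m ℓ → ℝ) (hx01 : ∀ z, x z ∈ Set.Icc (0 : ℝ) 1)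
    (heq : IsGadgetEquilibrium S α' gadgetS x) :
    ∀ i : Fin n, 0 < x (uVert i : GadgetV n m ℓ) →
      ∃ j, i ∈ S j ∧ α' (vVert j : GadgetV n m ℓ) < 1 := by
  intro i hi
  by_contra! hclosed
  have hv : ∀ j, i ∈ S j → x (vVert j) = 0 := by
    intro j hj
    have hα : α' (vVert j) = 1 := le_antisymm (hα' _).2 (hclosed j hj)
    have h := (heq (vVert j)).1 (by simp [gadgetNbrs])
    simpa [hα, gadgetS] using h
  have hsum : ∑ z ∈ gadgetNbrs S (uVert i : GadgetV n m ℓ), x z = 0 := by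
    refine Finset.sum_eq_zero fun z hz => ?_
    simp only [gadgetNbrs, Finset.mem_image, Finset.mem_filter, Finset.mem_univ,
      true_and] at hz
    obtain ⟨j, hj, rfl⟩ := hz
    exact hv j hj
  obtain ⟨j, hj⟩ := hcover i
  have hne : (gadgetNbrs S (uVert i : GadgetV n m ℓ)).Nonempty :=
    ⟨vVert j, by simp [gadgetNbrs, hj]⟩
  have h := (heq (uVert i)).1 hne
  rw [hsum] at h
  simp only [gadgetS, mul_zero, zero_div, add_zero] at h
  exact hi.ne' h
end

section
/- Consider the directed FJ model on a finite directed acyclic graph G. For every choice of resistances α ∈ [0,1]^V and innate opinions s ∈ ℝ^V there is exactly one equilibrium x. Moreover, the equilibrium is local: if two parameter choices (α, s) and (α', s') agree at every vertex reachable from a vertex u (including u itself), then their equilibria take the same value at u. -/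
/-- Equilibrium of the directed FJ model on a finite directed graph with edge relation
`E` and positive edge weights `w`: every vertex with at least one out-neighbor takes the
weighted average `x z = α z * s z + (1 - α z) * (∑ w(z,z') x z') / (∑ w(z,z'))`, and
every vertex with no out-neighbor satisfies `x z = s z`. -/
def IsDirFJEquilibrium {V : Type*} [Fintype V] (E : V → V → Prop) [DecidableRel E]
    (w : V → V → ℝ) (α s x : V → ℝ) : Prop :=
  ∀ z : V,
    ((Finset.univ.filter (E z)).Nonempty →
      x z = α z * s z +
        (1 - α z) * ((∑ z' ∈ Finset.univ.filter (E z), w z z' * x z') /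
          (∑ z' ∈ Finset.univ.filter (E z), w z z'))) ∧
    (¬ (Finset.univ.filter (E z)).Nonempty → x z = s z)

/-- On a finite acyclic digraph, passing to an out-neighbor is well founded. -/
theorem wellFounded_flip_of_acyclic {V : Type*} [Finite V] {E : V → V → Prop}
    (hacyc : ∀ z, ¬ Relation.TransGen E z z) : WellFounded (flip E) := by
  let : Std.Irrefl (flip (Relation.TransGen E)) := ⟨hacyc⟩
  let : IsTrans V (flip (Relation.TransGen E)) := ⟨fun _ _ _ h₁ h₂ => h₂.trans h₁⟩
  exact Subrelation.wf (r := flip (Relation.TransGen E))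
    (fun h => Relation.TransGen.single h) (Finite.wellFounded_of_trans_of_irrefl _)

open Classical in
/-- If passing to an out-neighbor is well founded, an equilibrium exists. -/
theorem IsDirFJEquilibrium.exists_of_wellFounded {V : Type*} [Fintype V] {E : V → V → Prop}
    [DecidableRel E] (hwf : WellFounded (flip E)) (w : V → V → ℝ) (α s : V → ℝ) :
    ∃ x, IsDirFJEquilibrium E w α s x := by
  let step : ∀ z, (∀ y, flip E y z → ℝ) → ℝ := fun z x =>
    if (Finset.univ.filter (E z)).Nonempty then
      α z * s z + (1 - α z) *
        ((∑ y ∈ Finset.univ.filter (E z), w z y * if h : E z y then x y h else 0) /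
          ∑ y ∈ Finset.univ.filter (E z), w z y)
    else s z
  refine ⟨hwf.fix step, fun z => ⟨fun hz => ?_, fun hz => ?_⟩⟩
  · rw [hwf.fix_eq]
    simp only [step, if_pos hz]
    congr 3
    refine Finset.sum_congr rfl fun y hy => ?_
    rw [dif_pos (Finset.mem_filter.mp hy).2]
  · rw [hwf.fix_eq]
    simp only [step, if_neg hz]

/-- If passing to an out-neighbor is well founded, the value of an equilibrium at a vertex
depends only on the parameters at the vertices reachable from it. -/
theorem IsDirFJEquilibrium.eq_of_eq_on_reachable {V : Type*} [Fintype V] {E : V → V → Prop}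
    [DecidableRel E] (hwf : WellFounded (flip E)) {w : V → V → ℝ} {α s α' s' x x' : V → ℝ}
    (hx : IsDirFJEquilibrium E w α s x) (hx' : IsDirFJEquilibrium E w α' s' x') (u : V)
    (h : ∀ v, Relation.ReflTransGen E u v → α v = α' v ∧ s v = s' v) : x u = x' u := by
  induction u using hwf.induction with
  | _ u ih =>
    obtain ⟨hα, hs⟩ := h u .refl
    by_cases hu : (Finset.univ.filter (E u)).Nonempty
    · have hsum : ∑ y ∈ Finset.univ.filter (E u), w u y * x y =
          ∑ y ∈ Finset.univ.filter (E u), w u y * x' y := by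
        refine Finset.sum_congr rfl fun y hy => ?_
        have huy : E u y := (Finset.mem_filter.mp hy).2
        rw [ih y huy fun v hv => h v (hv.head huy)]
      rw [(hx u).1 hu, (hx' u).1 hu, hα, hs, hsum]
    · rw [(hx u).2 hu, (hx' u).2 hu, hs]

/-- On a finite DAG the directed FJ model has exactly one equilibrium
for every choice of resistances `α ∈ [0,1]^V` and innate opinions `s`, and the
equilibrium is local: if two parameter choices agree at every vertex reachable from `u`,
their equilibria agree at `u`. -/
theorem dirFJ_dag_existsUnique_and_local
    {V : Type*} [Fintype V] (E : V → V → Prop) [DecidableRel E]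
    (w : V → V → ℝ) (hw : ∀ z z', E z z' → 0 < w z z')
    (hacyc : ∀ z, ¬ Relation.TransGen E z z) :
    (∀ α s : V → ℝ, (∀ v, α v ∈ Set.Icc (0 : ℝ) 1) →
      ∃! x : V → ℝ, IsDirFJEquilibrium E w α s x) ∧
    (∀ (α s α' s' x x' : V → ℝ) (u : V),
      (∀ v, α v ∈ Set.Icc (0 : ℝ) 1) → (∀ v, α' v ∈ Set.Icc (0 : ℝ) 1) →
      IsDirFJEquilibrium E w α s x → IsDirFJEquilibrium E w α' s' x' →
      (∀ v, Relation.ReflTransGen E u v → α v = α' v ∧ s v = s' v) →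
      x u = x' u) := by
  have hwf := wellFounded_flip_of_acyclic hacyc
  refine ⟨fun α s _ => ?_, fun α s α' s' x x' u _ _ hx hx' h =>
    hx.eq_of_eq_on_reachable hwf hx' u h⟩
  obtain ⟨x, hx⟩ := IsDirFJEquilibrium.exists_of_wellFounded hwf w α s
  exact ⟨x, hx, fun y hy => funext fun u =>
    IsDirFJEquilibrium.eq_of_eq_on_reachable hwf hy hx u fun _ _ => ⟨rfl, rfl⟩⟩
end

section
/- Consider the directed FJ model on a finite directed acyclic graph G, with fixed innate opinions s ∈ ℝ^V and fixed resistances at all vertices other than a designated vertex u. For t ∈ [0,1], let x_t denote the (unique) equilibrium obtained when α(u) = t. Then for every vertex z, the map t ↦ x_t(z) is an affine function of t on [0,1]; in particular, its maximum over t ∈ [0,1] is attained at t = 0 or at t = 1. -/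
/-- A relation without cycles on a finite type is well-founded in the direction of its edges. -/
theorem wellFounded_swap_of_acyclic {V : Type*} [Finite V] {E : V → V → Prop}
    (hacyc : ∀ z, ¬ Relation.TransGen E z z) : WellFounded (fun z' z => E z z') := by
  let r : V → V → Prop := fun z' z => Relation.TransGen E z z'
  have : IsTrans V r := ⟨fun _ _ _ hab hbc => hbc.trans hab⟩
  have : Std.Irrefl r := ⟨hacyc⟩
  exact Subrelation.wf (r := r) (fun h => Relation.TransGen.single h)
    (Finite.wellFounded_of_trans_of_irrefl r)

/-- The equilibrium opinion at `z` is affine in the resistance of `u`, with slope zero when `u`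
cannot be reached from `z`. -/
theorem IsDirFJEquilibrium.exists_affine {V : Type*} [Fintype V] [DecidableEq V]
    {E : V → V → Prop} [DecidableRel E] {w : V → V → ℝ}
    (hacyc : ∀ z, ¬ Relation.TransGen E z z) {α s : V → ℝ} {u : V} {x : ℝ → V → ℝ} {S : Set ℝ}
    (hx : ∀ t ∈ S, IsDirFJEquilibrium E w (Function.update α u t) s (x t)) (z : V) :
    ∃ a b : ℝ, (¬ Relation.ReflTransGen E z u → a = 0) ∧ ∀ t ∈ S, x t z = a * t + b := by
  induction z using (wellFounded_swap_of_acyclic hacyc).induction with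
  | _ z ih =>
    by_cases hne : (Finset.univ.filter (E z)).Nonempty
    swap
    · exact ⟨0, s z, fun _ => rfl, fun t ht => by simp [(hx t ht z).2 hne]⟩
    choose! a b ha hab using ih
    have hsum : ∀ t ∈ S, ∑ z' ∈ Finset.univ.filter (E z), w z z' * x t z' =
        (∑ z' ∈ Finset.univ.filter (E z), w z z' * a z') * t +
          ∑ z' ∈ Finset.univ.filter (E z), w z z' * b z' := by
      intro t ht
      rw [Finset.sum_mul, ← Finset.sum_add_distrib]
      refine Finset.sum_congr rfl fun z' hz' => ?_
      rw [hab z' (Finset.mem_filter.mp hz').2 t ht]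
      ring
    have hslope : (∀ z', E z z' → ¬ Relation.ReflTransGen E z' u) →
        ∑ z' ∈ Finset.univ.filter (E z), w z z' * a z' = 0 := by
      intro h
      refine Finset.sum_eq_zero fun z' hz' => ?_
      have hE := (Finset.mem_filter.mp hz').2
      rw [ha z' hE (h z' hE), mul_zero]
    set A := ∑ z' ∈ Finset.univ.filter (E z), w z z' * a z'
    set B := ∑ z' ∈ Finset.univ.filter (E z), w z z' * b z'
    set W := ∑ z' ∈ Finset.univ.filter (E z), w z z'
    by_cases hzu : z = u
    · have hA : A = 0 := hslope fun z' hE hr =>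
        hacyc z (Relation.TransGen.head' hE (hzu ▸ hr))
      refine ⟨s z - B / W, B / W, fun h => absurd (hzu ▸ Relation.ReflTransGen.refl) h,
        fun t ht => ?_⟩
      have hu : Function.update α u t z = t := by rw [hzu, Function.update_self]
      rw [(hx t ht z).1 hne, hsum t ht, hA, hu]
      ring
    · refine ⟨(1 - α z) * (A / W), α z * s z + (1 - α z) * (B / W), fun h => ?_,
        fun t ht => ?_⟩
      · rw [hslope fun z' hE hr => h (Relation.ReflTransGen.head hE hr)]
        simp
      · rw [(hx t ht z).1 hne, hsum t ht, Function.update_of_ne hzu]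
        ring

/-- On a finite DAG, fix innate opinions `s` and resistances at all
vertices except a designated vertex `u`, and for `t ∈ [0,1]` let `x t` be the (unique)
equilibrium when `α u = t`. Then for every vertex `z` the map `t ↦ x t z` is affine on
`[0,1]`; in particular its maximum over `[0,1]` is attained at `t = 0` or `t = 1`. -/
theorem dirFJ_dag_affine_in_resistance
    {V : Type*} [Fintype V] [DecidableEq V] (E : V → V → Prop) [DecidableRel E]
    (w : V → V → ℝ) (hw : ∀ z z', E z z' → 0 < w z z')
    (hacyc : ∀ z, ¬ Relation.TransGen E z z)
    (α s : V → ℝ) (hα : ∀ v, α v ∈ Set.Icc (0 : ℝ) 1)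
    (u : V) (x : ℝ → V → ℝ)
    (hx : ∀ t ∈ Set.Icc (0 : ℝ) 1,
      IsDirFJEquilibrium E w (Function.update α u t) s (x t)) :
    ∀ z : V, ∃ a b : ℝ,
      (∀ t ∈ Set.Icc (0 : ℝ) 1, x t z = a * t + b) ∧
      (∀ t ∈ Set.Icc (0 : ℝ) 1, x t z ≤ max (x 0 z) (x 1 z)) := by
  intro z
  obtain ⟨a, b, -, hab⟩ := IsDirFJEquilibrium.exists_affine hacyc hx z
  refine ⟨a, b, hab, fun t ht => ?_⟩
  rw [hab t ht, hab 0 (by simp), hab 1 (by simp)]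
  rcases le_total 0 a with h | h
  · exact le_max_of_le_right (by nlinarith [ht.2])
  · exact le_max_of_le_left (by nlinarith [ht.1])
end
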